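/- For all τ ∈ ℝ one has b(τ) H̃(τ) − b'(τ) H(τ) = a(τ). Consequently, for any real numbers x, y, if M = (b'(τ) x − b(τ) y)/a(τ) and W = H̃(τ) x − H(τ) y, then x = (b(τ) W − a(τ) H(τ) M)/a(τ) and y = (b'(τ) W − a(τ) H̃(τ) M)/a(τ). -/

import Mathlib

/-- `a(τ) = 2√2/(e^τ + e^{−τ})`. -/
noncomputable def aa (τ : ℝ) : ℝ := 2 * Real.sqrt 2 / (Real.exp τ + Real.exp (-τ))

/-- `b(τ) = 2√2 (e^{−τ} − e^τ)/(e^τ + e^{−τ})²`. -/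
noncomputable def bb (τ : ℝ) : ℝ :=
  2 * Real.sqrt 2 * (Real.exp (-τ) - Real.exp τ) / (Real.exp τ + Real.exp (-τ)) ^ 2

/-- `b'(τ) = a(τ) − a(τ)³`. -/
noncomputable def bder (τ : ℝ) : ℝ := aa τ - (aa τ) ^ 3

/-- `h(τ) = 3(e^{2τ} − e^{−2τ} + 4τ)/(2(e^τ + e^{−τ})²)`. -/
noncomputable def hh (τ : ℝ) : ℝ :=
  3 * (Real.exp (2 * τ) - Real.exp (-(2 * τ)) + 4 * τ) / (2 * (Real.exp τ + Real.exp (-τ)) ^ 2)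

/-- `H(τ) = (b(τ)h(τ) + a(τ))/a(τ)`. -/
noncomputable def HH (τ : ℝ) : ℝ := (bb τ * hh τ + aa τ) / aa τ

/-- `H̃(τ) = (b'(τ)h(τ) + 2b(τ))/a(τ)`. -/
noncomputable def HT (τ : ℝ) : ℝ := (bder τ * hh τ + 2 * bb τ) / aa τ

theorem aa_pos (τ : ℝ) : 0 < aa τ := by
  unfold aa
  positivity

theorem bb_sq (τ : ℝ) : 2 * bb τ ^ 2 = 2 * aa τ ^ 2 - aa τ ^ 4 := by
  have hs : Real.sqrt 2 ^ 2 = 2 := Real.sq_sqrt (by norm_num)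
  have hs4 : Real.sqrt 2 ^ 4 = 4 := by
    rw [show Real.sqrt 2 ^ 4 = (Real.sqrt 2 ^ 2) ^ 2 by ring, hs]
    norm_num
  have he : Real.exp τ * Real.exp (-τ) = 1 := by
    rw [← Real.exp_add, add_neg_cancel, Real.exp_zero]
  have hpos : Real.exp τ + Real.exp (-τ) ≠ 0 := by positivity
  unfold aa bb
  simp only [div_pow, mul_pow, hs, hs4]
  field_simp
  linear_combination (-4) * he

theorem bb_mul_HT_sub_bder_mul_HH (τ : ℝ) :
    bb τ * HT τ - bder τ * HH τ = aa τ := by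
  have ha := (aa_pos τ).ne'
  unfold HT HH
  field_simp
  unfold bder
  linear_combination bb_sq τ

/-- `bH̃ − b'H = a`, and consequently the change of coordinates
`M = (b'x − by)/a`, `W = H̃x − Hy` is inverted by
`x = (bW − aHM)/a`, `y = (b'W − aH̃M)/a`. -/
theorem wronskian_and_inverse_coordinates (τ : ℝ) :
    bb τ * HT τ - bder τ * HH τ = aa τ ∧
    ∀ x y M W : ℝ,
      M = (bder τ * x - bb τ * y) / aa τ →
      W = HT τ * x - HH τ * y →
      x = (bb τ * W - aa τ * HH τ * M) / aa τ ∧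
      y = (bder τ * W - aa τ * HT τ * M) / aa τ := by
  have ha := (aa_pos τ).ne'
  have hw := bb_mul_HT_sub_bder_mul_HH τ
  refine ⟨hw, ?_⟩
  rintro x y M W rfl rfl
  constructor
  · rw [eq_div_iff ha, mul_right_comm, mul_div_cancel₀ _ ha]
    linear_combination (-x) * hw
  · rw [eq_div_iff ha, mul_right_comm, mul_div_cancel₀ _ ha]
    linear_combination (-y) * hw
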